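/- (Watson's formula) Let ν ∈ ℂ with Re(ν) > 0 and let z ∈ ℂ with Re(z) > 0. Then (1/2) Γ(ν) + 2 ∑_{n=1}^∞ (nz/2)^ν K_ν(nz) = √π Γ(ν + 1/2) z^{2ν} { 1/z^{2ν+1} + 2 ∑_{n=1}^∞ 1/(z² + 4n²π²)^{ν+1/2} }, both series converging absolutely (all complex powers are principal branches). -/

import Mathlib

open MeasureTheory Filter Complex

/-- The modified Bessel function of the second kind `K_ν(z)` for `ν, z ∈ ℂ` with `Re z > 0`,
`K_ν(z) = ∫_0^∞ e^{-z cosh t} cosh(ν t) dt`. -/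
noncomputable def besselK (ν z : ℂ) : ℂ :=
  ∫ t in Set.Ioi (0:ℝ), Complex.exp (-z * Real.cosh t) * Complex.cosh (ν * t)

section BesselBounds

lemma integrable_exp_neg_mul_cosh_add {a : ℝ} (ha : 0 < a) (b : ℝ) :
    Integrable (fun t : ℝ => Real.exp (-a * Real.cosh t + b * t)) := by
  have hgauss : Integrable (fun t : ℝ => Real.exp (-(a / 4) * t ^ 2 + b * t)) := by
    have h := (integrable_cexp_quadratic (b := ((a / 4 : ℝ) : ℂ))
      (by rw [ofReal_re]; positivity) b 0).norm
    refine h.congr (.of_forall fun t => ?_)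
    simp only [Complex.norm_exp]
    congr 1
    simp [pow_two]
  refine hgauss.mono' (by fun_prop) (.of_forall fun t => ?_)
  rw [Real.norm_of_nonneg (Real.exp_pos _).le, Real.exp_le_exp]
  have h1 := Real.quadratic_le_exp_of_nonneg (abs_nonneg t)
  have h2 := Real.exp_pos (-|t|)
  have h3 : t ^ 2 / 4 ≤ Real.cosh t := by
    rw [← Real.cosh_abs, Real.cosh_eq]
    have := abs_nonneg t
    have := sq_abs t
    linarith
  nlinarith

lemma norm_cosh_mul_le (ν : ℂ) {t : ℝ} (ht : 0 ≤ t) :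
    ‖Complex.cosh (ν * t)‖ ≤ Real.exp (|ν.re| * t) := by
  have h : ∀ w : ℂ, |w.re| = |ν.re| → ‖Complex.exp (w * t)‖ ≤ Real.exp (|ν.re| * t) := by
    intro w hw
    rw [Complex.norm_exp, Real.exp_le_exp, re_mul_ofReal, ← hw]
    exact mul_le_mul_of_nonneg_right (le_abs_self _) ht
  have h1 := h ν rfl
  have h2 := h (-ν) (by simp)
  rw [neg_mul] at h2
  rw [Complex.cosh, norm_div, Complex.norm_ofNat]
  linarith [norm_add_le (Complex.exp (ν * t)) (Complex.exp (-(ν * t)))]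

lemma norm_exp_neg_mul_cosh (z : ℂ) (t : ℝ) :
    ‖Complex.exp (-z * Real.cosh t)‖ = Real.exp (-z.re * Real.cosh t) := by
  rw [Complex.norm_exp, re_mul_ofReal, neg_re]

lemma norm_besselK_integrand_le (ν z : ℂ) {t : ℝ} (ht : 0 ≤ t) :
    ‖Complex.exp (-z * Real.cosh t) * Complex.cosh (ν * t)‖ ≤
      Real.exp (-z.re * Real.cosh t + |ν.re| * t) := by
  rw [norm_mul, norm_exp_neg_mul_cosh, Real.exp_add]
  exact mul_le_mul_of_nonneg_left (norm_cosh_mul_le ν ht) (Real.exp_pos _).le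

lemma integrableOn_besselK_integrand (ν : ℂ) {z : ℂ} (hz : 0 < z.re) :
    IntegrableOn (fun t : ℝ => Complex.exp (-z * Real.cosh t) * Complex.cosh (ν * t))
      (Set.Ioi 0) := by
  refine (integrable_exp_neg_mul_cosh_add hz |ν.re|).integrableOn.mono'
    (by fun_prop) ?_
  filter_upwards [ae_restrict_mem measurableSet_Ioi] with t ht
  exact norm_besselK_integrand_le ν z (le_of_lt ht)

lemma differentiableAt_besselK (ν : ℂ) {z : ℂ} (hz : 0 < z.re) :
    DifferentiableAt ℂ (besselK ν) z := by
  have hs : {w : ℂ | z.re / 2 < w.re} ∈ nhds z :=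
    (isOpen_lt continuous_const continuous_re).mem_nhds (by simpa using hz)
  refine (hasDerivAt_integral_of_dominated_loc_of_deriv_le
    (F := fun w (t : ℝ) => Complex.exp (-w * Real.cosh t) * Complex.cosh (ν * t))
    (F' := fun w (t : ℝ) =>
      -(Real.cosh t : ℂ) * (Complex.exp (-w * Real.cosh t) * Complex.cosh (ν * t)))
    (bound := fun t => Real.exp (-(z.re / 2) * Real.cosh t + (|ν.re| + 1) * t)) hs
    (.of_forall fun w => by fun_prop) (integrableOn_besselK_integrand ν hz)
    (by fun_prop) ?_ (integrable_exp_neg_mul_cosh_add (half_pos hz) _).integrableOn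
    (.of_forall fun t w _ => ?_)).2.differentiableAt
  · filter_upwards [ae_restrict_mem measurableSet_Ioi] with t ht w hw
    have ht0 : 0 ≤ t := le_of_lt ht
    have hc : Real.cosh t ≤ Real.exp t := by
      rw [Real.cosh_eq]
      linarith [Real.exp_le_exp.2 (by linarith : -t ≤ t)]
    rw [norm_mul, norm_neg, norm_real, Real.norm_of_nonneg (Real.cosh_pos t).le]
    calc Real.cosh t * ‖Complex.exp (-w * Real.cosh t) * Complex.cosh (ν * t)‖
        ≤ Real.exp t * Real.exp (-w.re * Real.cosh t + |ν.re| * t) :=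
          mul_le_mul hc (norm_besselK_integrand_le ν w ht0) (norm_nonneg _) (Real.exp_pos _).le
      _ ≤ _ := by
          rw [← Real.exp_add, Real.exp_le_exp]
          have : z.re / 2 < w.re := hw
          nlinarith [Real.cosh_pos t]
  · have h := (((hasDerivAt_id w).neg.mul_const (Real.cosh t : ℂ)).cexp).mul_const
      (Complex.cosh (ν * t))
    exact h.congr_deriv (by simp only [Pi.neg_apply, id_eq]; ring)

/-- Exponential decay of `K_ν` in the right half plane, uniform away from the imaginary axis. -/
lemma exists_norm_besselK_le (ν : ℂ) {ε : ℝ} (hε : 0 < ε) :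
    ∃ M : ℝ, ∀ w : ℂ, ε ≤ w.re → ‖besselK ν w‖ ≤ M * Real.exp (-(w.re - ε)) := by
  refine ⟨∫ t in Set.Ioi (0 : ℝ), Real.exp (-ε * Real.cosh t + |ν.re| * t), fun w hw => ?_⟩
  rw [← integral_mul_const]
  refine norm_integral_le_of_norm_le
    ((integrable_exp_neg_mul_cosh_add hε _).integrableOn.mul_const _) ?_
  filter_upwards [ae_restrict_mem measurableSet_Ioi] with t ht
  refine (norm_besselK_integrand_le ν w (le_of_lt ht)).trans ?_
  rw [← Real.exp_add, Real.exp_le_exp]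
  nlinarith [Real.one_le_cosh t]

/-- `K_ν` as an integral over the whole line. -/
lemma integral_exp_neg_mul_cosh_mul_exp (ν : ℂ) {a : ℝ} (ha : 0 < a) :
    ∫ t : ℝ, Complex.exp (-(a : ℂ) * Real.cosh t) * Complex.exp (ν * t) =
      2 * besselK ν a := by
  have hline : Integrable
      (fun t : ℝ => Complex.exp (-(a : ℂ) * Real.cosh t) * Complex.exp (ν * t)) := by
    refine (integrable_exp_neg_mul_cosh_add ha ν.re).mono' (by fun_prop) (.of_forall fun t => ?_)
    rw [norm_mul, norm_exp_neg_mul_cosh, Complex.norm_exp, re_mul_ofReal, ofReal_re, Real.exp_add]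
  rw [← intervalIntegral.integral_Iic_add_Ioi (b := 0) hline.integrableOn hline.integrableOn]
  have hneg := integral_comp_neg_Ioi (0 : ℝ)
    (fun t : ℝ => Complex.exp (-(a : ℂ) * Real.cosh t) * Complex.exp (ν * t))
  rw [neg_zero] at hneg
  have hreflected : IntegrableOn (fun t : ℝ => Complex.exp (-(a : ℂ) * Real.cosh (-t)) *
      Complex.exp (ν * (-t : ℝ))) (Set.Ioi 0) := hline.comp_neg.integrableOn
  rw [← hneg, ← integral_add hreflected hline.integrableOn, besselK, ← integral_const_mul]
  congr 1 with t
  rw [Real.cosh_neg, ofReal_neg, mul_neg, ← mul_add, Complex.cosh]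
  ring

lemma ofReal_mul_exp_cpow {c : ℝ} (hc : 0 < c) (t : ℝ) (ν : ℂ) :
    ((c * Real.exp t : ℝ) : ℂ) ^ ν = (c : ℂ) ^ ν * Complex.exp (ν * t) := by
  rw [ofReal_mul, mul_cpow_ofReal_nonneg hc.le (Real.exp_pos t).le,
    cpow_def_of_ne_zero (ofReal_ne_zero.2 (Real.exp_pos t).ne'), ← ofReal_log (Real.exp_pos t).le,
    Real.log_exp, mul_comm ν]

lemma integral_cpow_mul_exp_neg_add_div (ν : ℂ) {x m : ℝ} (hx : 0 < x) (hm : 0 < m) :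
    ∫ u in Set.Ioi (0 : ℝ), (u : ℂ) ^ (ν - 1) * Real.exp (-(u * x ^ 2 + m ^ 2 / (4 * u))) =
      2 * ((m / (2 * x) : ℝ) : ℂ) ^ ν * besselK ν (m * x : ℝ) := by
  set c : ℝ := m / (2 * x) with hc_def
  have hc : 0 < c := by positivity
  have himage : (fun t : ℝ => c * Real.exp t) '' Set.univ = Set.Ioi 0 := by
    ext u
    simp only [Set.image_univ, Set.mem_range, Set.mem_Ioi]
    refine ⟨fun ⟨t, ht⟩ => ht ▸ by positivity, fun hu => ⟨Real.log (u / c), ?_⟩⟩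
    rw [Real.exp_log (by positivity)]
    field_simp
  have key := integral_image_eq_integral_abs_deriv_smul MeasurableSet.univ
    (fun t _ => ((Real.hasDerivAt_exp t).const_mul c).hasDerivWithinAt)
    (fun s _ t _ h => Real.exp_injective (mul_left_cancel₀ hc.ne' h))
    (fun u : ℝ => (u : ℂ) ^ (ν - 1) * Real.exp (-(u * x ^ 2 + m ^ 2 / (4 * u))))
  rw [himage] at key
  rw [key, setIntegral_univ, mul_assoc, mul_left_comm,
    ← integral_exp_neg_mul_cosh_mul_exp ν (by positivity : 0 < m * x), ← integral_const_mul]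
  congr 1 with t
  have hpos : 0 < c * Real.exp t := by positivity
  have hne : ((c * Real.exp t : ℝ) : ℂ) ≠ 0 := ofReal_ne_zero.2 hpos.ne'
  have hexp : -(c * Real.exp t * x ^ 2 + m ^ 2 / (4 * (c * Real.exp t))) =
      -(m * x) * Real.cosh t := by
    rw [Real.cosh_eq, Real.exp_neg, hc_def]
    have := Real.exp_pos t
    field_simp
    ring
  rw [abs_of_pos hpos, hexp, real_smul, cpow_sub _ _ hne, cpow_one, ← mul_assoc,
    mul_div_cancel₀ _ hne, ofReal_mul_exp_cpow hc]
  push_cast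
  ring

end BesselBounds

section Summation

lemma norm_cpow_le_rpow_mul_exp (w ν : ℂ) :
    ‖w ^ ν‖ ≤ ‖w‖ ^ ν.re * Real.exp (Real.pi * |ν.im|) := by
  refine (norm_cpow_le w ν).trans ?_
  rw [div_eq_mul_inv, ← Real.exp_neg]
  refine mul_le_mul_of_nonneg_left (Real.exp_le_exp.2 ?_) (by positivity)
  calc -(arg w * ν.im) ≤ |arg w * ν.im| := neg_le_abs _
    _ = |arg w| * |ν.im| := abs_mul _ _
    _ ≤ _ := mul_le_mul_of_nonneg_right (abs_arg_le_pi w) (abs_nonneg _)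

lemma summable_succ_rpow_mul_exp_neg (σ : ℝ) {ε : ℝ} (hε : 0 < ε) :
    Summable fun n : ℕ => ((n + 1 : ℕ) : ℝ) ^ σ * Real.exp (-ε * (n + 1 : ℕ)) := by
  refine .of_nonneg_of_le (fun n => by positivity) (fun n => ?_)
    ((summable_nat_add_iff 1).2 (Real.summable_pow_mul_exp_neg_nat_mul ⌈σ⌉₊ hε))
  refine mul_le_mul_of_nonneg_right ?_ (Real.exp_pos _).le
  rw [← Real.rpow_natCast]
  exact Real.rpow_le_rpow_of_exponent_le (by simp) (Nat.le_ceil σ)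

lemma exists_summable_bound_besselK {ν : ℂ} (hν : 0 < ν.re) {ε : ℝ} (hε : 0 < ε) (R : ℝ) :
    ∃ u : ℕ → ℝ, Summable u ∧ ∀ n : ℕ, ∀ z : ℂ, ε < z.re → ‖z‖ < R →
      ‖((n + 1 : ℕ) * z / 2) ^ ν * besselK ν ((n + 1 : ℕ) * z)‖ ≤ u n := by
  obtain ⟨M, hM⟩ := exists_norm_besselK_le ν (half_pos hε)
  refine ⟨fun n => (R ^ ν.re * Real.exp (Real.pi * |ν.im|) * |M|) *
      (((n + 1 : ℕ) : ℝ) ^ ν.re * Real.exp (-(ε / 2) * (n + 1 : ℕ))),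
    (summable_succ_rpow_mul_exp_neg ν.re (half_pos hε)).mul_left _, fun n z hz hzR => ?_⟩
  have hR : 0 ≤ R := (norm_nonneg z).trans hzR.le
  have hn : (1 : ℝ) ≤ (n + 1 : ℕ) := by simp
  have hre : (((n + 1 : ℕ) : ℂ) * z).re = (n + 1 : ℕ) * z.re := by
    rw [← ofReal_natCast, re_ofReal_mul]
  have h1 : ‖((n + 1 : ℕ) * z / 2) ^ ν‖ ≤
      (((n + 1 : ℕ) : ℝ) ^ ν.re * R ^ ν.re) * Real.exp (Real.pi * |ν.im|) := by
    refine (norm_cpow_le_rpow_mul_exp _ _).trans ?_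
    rw [← Real.mul_rpow (by positivity) hR]
    gcongr
    rw [norm_div, norm_mul, norm_natCast, Complex.norm_ofNat]
    have := mul_le_mul_of_nonneg_left hzR.le (by positivity : (0 : ℝ) ≤ (n + 1 : ℕ))
    have : 0 ≤ ((n + 1 : ℕ) : ℝ) * ‖z‖ := by positivity
    linarith
  have h2 : ‖besselK ν ((n + 1 : ℕ) * z)‖ ≤ |M| * Real.exp (-(ε / 2) * (n + 1 : ℕ)) := by
    refine (hM _ (by rw [hre]; nlinarith)).trans ?_
    gcongr
    · exact le_abs_self M
    · rw [hre]
      nlinarith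
  rw [norm_mul]
  refine (mul_le_mul h1 h2 (norm_nonneg _) (by positivity)).trans_eq ?_
  ring

/-- The quadratic lower bound comes from the factorisation `(z + 2nπi)(z - 2nπi)`. -/
lemma exists_mul_sq_le_norm_sq_add {ε : ℝ} (hε : 0 < ε) (R : ℝ) :
    ∃ c : ℝ, 0 < c ∧ ∀ m : ℝ, 1 ≤ m → ∀ z : ℂ, ε < z.re → ‖z‖ < R →
      c * m ^ 2 ≤ ‖z ^ 2 + 4 * (m : ℂ) ^ 2 * (Real.pi : ℂ) ^ 2‖ := by
  rcases le_or_gt R 0 with hR | hR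
  · exact ⟨1, one_pos, fun m _ z _ hzR => absurd (norm_nonneg z) (by linarith)⟩
  set c := min 1 (ε / R) with hc_def
  have hc : 0 < c := lt_min one_pos (by positivity)
  have hc1 : c ≤ 1 := min_le_left _ _
  have hcR : c * R ≤ ε := (le_div_iff₀ hR).1 (min_le_right _ _)
  refine ⟨c * c, by positivity, fun m hm z hz hzR => ?_⟩
  have hfactor : ∀ a : ℝ, |a| = 2 * m * Real.pi → c * m ≤ ‖z + a * I‖ := by
    intro a ha
    have h1 : ε ≤ ‖z + a * I‖ := by
      have := (le_abs_self _).trans (abs_re_le_norm (z + a * I))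
      simp at this
      linarith
    have h2 : 2 * m * Real.pi - R ≤ ‖z + a * I‖ := by
      have := norm_sub_le (z + a * I) z
      rw [add_sub_cancel_left, norm_mul, norm_I, mul_one, norm_real, Real.norm_eq_abs, ha] at this
      linarith
    rcases le_total m R with h | h
    · nlinarith
    · nlinarith [Real.pi_gt_three]
  have hm0 : 0 ≤ 2 * m * Real.pi := by positivity
  have hp := hfactor (2 * m * Real.pi) (abs_of_nonneg hm0)
  have hn := hfactor (-(2 * m * Real.pi)) (by rw [abs_neg, abs_of_nonneg hm0])
  have hprod : z ^ 2 + 4 * (m : ℂ) ^ 2 * (Real.pi : ℂ) ^ 2 =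
      (z + (2 * m * Real.pi : ℝ) * I) * (z + (-(2 * m * Real.pi) : ℝ) * I) := by
    push_cast
    linear_combination (4 * (m : ℂ) ^ 2 * (Real.pi : ℂ) ^ 2) * I_sq
  rw [hprod, norm_mul]
  exact (by ring : c * c * m ^ 2 = (c * m) * (c * m)).trans_le
    (mul_le_mul hp hn (by positivity) (norm_nonneg _))

lemma exists_summable_bound_inv_cpow {s : ℂ} (hs : 1 / 2 < s.re) {ε : ℝ} (hε : 0 < ε) (R : ℝ) :
    ∃ u : ℕ → ℝ, Summable u ∧ ∀ n : ℕ, ∀ z : ℂ, ε < z.re → ‖z‖ < R →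
      ‖1 / (z ^ 2 + 4 * ((n + 1 : ℕ) : ℂ) ^ 2 * (Real.pi : ℂ) ^ 2) ^ s‖ ≤ u n := by
  obtain ⟨c, hc, h⟩ := exists_mul_sq_le_norm_sq_add hε R
  refine ⟨fun n => (c ^ (-s.re) * Real.exp (Real.pi * |s.im|)) *
      ((n + 1 : ℕ) : ℝ) ^ (-(2 * s.re)),
    ((summable_nat_add_iff 1).2 (Real.summable_nat_rpow.2 (by linarith))).mul_left _,
    fun n z hz hzR => ?_⟩
  have hn : (0 : ℝ) < (n + 1 : ℕ) := by positivity
  have hb := h (n + 1 : ℕ) (by simp) z hz hzR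
  rw [ofReal_natCast] at hb
  rw [one_div, ← cpow_neg]
  refine (norm_cpow_le_rpow_mul_exp _ _).trans ?_
  beta_reduce
  rw [neg_re, neg_im, abs_neg, mul_right_comm (c ^ _)]
  refine mul_le_mul_of_nonneg_right ?_ (Real.exp_pos _).le
  refine (Real.rpow_le_rpow_of_nonpos (by positivity) hb (by linarith)).trans_eq ?_
  rw [Real.mul_rpow hc.le (by positivity), ← Real.rpow_natCast, ← Real.rpow_mul hn.le]
  congr 2
  push_cast
  ring

/-- A series of holomorphic functions on the right half plane that is dominated on every region
`ε < Re z`, `‖z‖ < R` has a holomorphic sum. -/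
lemma summable_and_differentiableOn_tsum {F : ℕ → ℂ → ℂ}
    (hF : ∀ n, DifferentiableOn ℂ (F n) {z | 0 < z.re})
    (hbound : ∀ ε : ℝ, 0 < ε → ∀ R : ℝ, ∃ u : ℕ → ℝ, Summable u ∧
      ∀ n, ∀ z : ℂ, ε < z.re → ‖z‖ < R → ‖F n z‖ ≤ u n) :
    (∀ z : ℂ, 0 < z.re → Summable fun n => F n z) ∧
      DifferentiableOn ℂ (fun z => ∑' n, F n z) {z | 0 < z.re} := by
  refine ⟨fun z hz => ?_, fun z hz => ?_⟩
  · obtain ⟨u, hu, h⟩ := hbound (z.re / 2) (half_pos hz) (‖z‖ + 1)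
    exact hu.of_norm_bounded fun n => h n z (half_lt_self hz) (lt_add_one _)
  · have hz0 : 0 < z.re := hz
    obtain ⟨u, hu, h⟩ := hbound (z.re / 2) (half_pos hz0) (‖z‖ + 1)
    have hopen : IsOpen {w : ℂ | z.re / 2 < w.re ∧ ‖w‖ < ‖z‖ + 1} :=
      (isOpen_lt continuous_const continuous_re).inter (isOpen_lt continuous_norm continuous_const)
    have hd := differentiableOn_tsum_of_summable_norm hu
      (fun n => (hF n).mono fun w hw => (half_pos hz0).trans hw.1) hopen
      (fun n w hw => h n w hw.1 hw.2)
    exact (hd.differentiableAt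
      (hopen.mem_nhds ⟨half_lt_self hz0, lt_add_one _⟩)).differentiableWithinAt

lemma sq_add_mem_slitPlane {z : ℂ} (hz : 0 < z.re) (m : ℕ) :
    z ^ 2 + 4 * (m : ℂ) ^ 2 * (Real.pi : ℂ) ^ 2 ∈ slitPlane := by
  have hcast : (4 * (m : ℂ) ^ 2 * (Real.pi : ℂ) ^ 2) =
      ((4 * (m : ℝ) ^ 2 * Real.pi ^ 2 : ℝ) : ℂ) := by push_cast; ring
  have hnn : 0 ≤ 4 * (m : ℝ) ^ 2 * Real.pi ^ 2 := by positivity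
  rw [mem_slitPlane_iff, hcast, add_re, add_im, ofReal_re, ofReal_im, add_zero, sq, mul_re, mul_im]
  by_cases him : z.im = 0
  · left
    rw [him]
    nlinarith
  · right
    rw [mul_comm z.im, ← two_mul]
    exact mul_ne_zero two_ne_zero (mul_ne_zero hz.ne' him)

lemma differentiableOn_cpow_mul_besselK (ν : ℂ) (n : ℕ) :
    DifferentiableOn ℂ (fun z : ℂ => ((n + 1 : ℕ) * z / 2) ^ ν * besselK ν ((n + 1 : ℕ) * z))
      {z | 0 < z.re} := by
  intro z hz
  have hre : 0 < (((n + 1 : ℕ) : ℂ) * z).re := by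
    rw [← ofReal_natCast, re_ofReal_mul]
    exact mul_pos (by positivity) hz
  have hslit : (((n + 1 : ℕ) : ℂ) * z / 2) ∈ slitPlane :=
    mem_slitPlane_iff.2 (.inl (by rw [div_ofNat_re]; positivity))
  have hK : DifferentiableAt ℂ (fun z : ℂ => besselK ν ((n + 1 : ℕ) * z)) z :=
    (differentiableAt_besselK ν hre).comp z (by fun_prop)
  have hpow : DifferentiableAt ℂ (fun z : ℂ => (((n + 1 : ℕ) : ℂ) * z / 2) ^ ν) z :=
    DifferentiableAt.cpow (by fun_prop) (by fun_prop) hslit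
  exact (hpow.mul hK).differentiableWithinAt

lemma differentiableOn_one_div_sq_add_cpow (s : ℂ) (n : ℕ) :
    DifferentiableOn ℂ
      (fun z : ℂ => 1 / (z ^ 2 + 4 * ((n + 1 : ℕ) : ℂ) ^ 2 * (Real.pi : ℂ) ^ 2) ^ s)
      {z | 0 < z.re} := by
  intro z hz
  have hslit := sq_add_mem_slitPlane hz (n + 1)
  refine DifferentiableAt.differentiableWithinAt (DifferentiableAt.div (by fun_prop)
    (DifferentiableAt.cpow (by fun_prop) (by fun_prop) hslit) ?_)
  exact fun h => slitPlane_ne_zero hslit (cpow_eq_zero_iff _ _ |>.1 h).1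

lemma hasSum_int_of_even {f : ℤ → ℂ} (heven : ∀ n, f (-n) = f n)
    (hf : Summable fun n : ℕ => f (n + 1 : ℕ)) :
    HasSum f (f 0 + 2 * ∑' n : ℕ, f (n + 1 : ℕ)) := by
  have h1 : HasSum (fun n : ℕ => f n) (f 0 + ∑' n : ℕ, f (n + 1 : ℕ)) := by
    have := (hasSum_nat_add_iff (f := fun n : ℕ => f n) 1).1 hf.hasSum
    simpa [add_comm] using this
  have h2 : HasSum (fun n : ℕ => f (-(n + 1 : ℤ))) (∑' n : ℕ, f (n + 1 : ℕ)) := by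
    simpa only [heven, Nat.cast_add, Nat.cast_one] using hf.hasSum
  convert HasSum.of_nat_of_neg_add_one h1 h2 using 1
  ring

end Summation

section RealArgument

lemma summable_and_differentiableOn_besselK_series {ν : ℂ} (hν : 0 < ν.re) :
    (∀ z : ℂ, 0 < z.re →
      Summable fun n : ℕ => ((n + 1 : ℕ) * z / 2) ^ ν * besselK ν ((n + 1 : ℕ) * z)) ∧
    DifferentiableOn ℂ
      (fun z : ℂ => ∑' n : ℕ, ((n + 1 : ℕ) * z / 2) ^ ν * besselK ν ((n + 1 : ℕ) * z))
      {z | 0 < z.re} :=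
  summable_and_differentiableOn_tsum (differentiableOn_cpow_mul_besselK ν)
    fun _ hε R => exists_summable_bound_besselK hν hε R

lemma summable_and_differentiableOn_inv_cpow_series {s : ℂ} (hs : 1 / 2 < s.re) :
    (∀ z : ℂ, 0 < z.re → Summable fun n : ℕ =>
      1 / (z ^ 2 + 4 * ((n + 1 : ℕ) : ℂ) ^ 2 * (Real.pi : ℂ) ^ 2) ^ s) ∧
    DifferentiableOn ℂ (fun z : ℂ => ∑' n : ℕ,
      1 / (z ^ 2 + 4 * ((n + 1 : ℕ) : ℂ) ^ 2 * (Real.pi : ℂ) ^ 2) ^ s)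
      {z | 0 < z.re} :=
  summable_and_differentiableOn_tsum (differentiableOn_one_div_sq_add_cpow s)
    fun _ hε R => exists_summable_bound_inv_cpow hs hε R

/-- The Mellin transform at `ν` of `u ↦ exp (-(u x² + m² / (4u)))`. -/
noncomputable def gaussMellin (ν : ℂ) (x m : ℝ) : ℂ :=
  ∫ u in Set.Ioi (0 : ℝ), (u : ℂ) ^ (ν - 1) * Real.exp (-(u * x ^ 2 + m ^ 2 / (4 * u)))

lemma ofReal_cpow_two_mul {x : ℝ} (hx : 0 ≤ x) (ν : ℂ) :
    (x : ℂ) ^ (2 * ν) = ((x ^ 2 : ℝ) : ℂ) ^ ν := by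
  rw [mul_comm, cpow_mul_ofNat, ofReal_pow, sq, sq, ← mul_cpow_ofReal_nonneg hx hx]

lemma gaussMellin_zero {ν : ℂ} (hν : 0 < ν.re) {x : ℝ} (hx : 0 < x) :
    gaussMellin ν x 0 = ((x : ℂ) ^ (2 * ν))⁻¹ * Gamma ν := by
  have h := integral_cpow_mul_exp_neg_mul_Ioi hν (sq_pos_of_pos hx)
  rw [one_div, inv_cpow _ _ (arg_ofReal_of_nonneg (sq_nonneg x) ▸ Real.pi_pos.ne),
    ← ofReal_cpow_two_mul hx.le] at h
  rw [← h, gaussMellin]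
  congr 1 with u
  simp [mul_comm]

lemma gaussMellin_succ (ν : ℂ) {x : ℝ} (hx : 0 < x) (n : ℕ) :
    gaussMellin ν x (n + 1 : ℕ) =
      2 * ((x : ℂ) ^ (2 * ν))⁻¹ *
        (((n + 1 : ℕ) * (x : ℂ) / 2) ^ ν * besselK ν ((n + 1 : ℕ) * x)) := by
  have hne : (x : ℂ) ^ (2 * ν) ≠ 0 := by simp [cpow_eq_zero_iff, hx.ne']
  have hpow : (((n + 1 : ℕ) : ℂ) * x / 2) ^ ν =
      (x : ℂ) ^ (2 * ν) * ((((n + 1 : ℕ) : ℝ) / (2 * x) : ℝ) : ℂ) ^ ν := by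
    rw [ofReal_cpow_two_mul hx.le, ← mul_cpow_ofReal_nonneg (by positivity) (by positivity)]
    congr 1
    have : (x : ℂ) ≠ 0 := ofReal_ne_zero.2 hx.ne'
    push_cast
    field_simp
  rw [gaussMellin, integral_cpow_mul_exp_neg_add_div ν hx (by positivity), hpow]
  push_cast
  field_simp

lemma norm_gaussMellin_integrand (ν : ℂ) (x m : ℝ) {u : ℝ} (hu : 0 < u) :
    ‖(u : ℂ) ^ (ν - 1) * Real.exp (-(u * x ^ 2 + m ^ 2 / (4 * u)))‖ =
      u ^ (ν.re - 1) * Real.exp (-(u * x ^ 2 + m ^ 2 / (4 * u))) := by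
  rw [norm_mul, norm_cpow_eq_rpow_re_of_pos hu, norm_real,
    Real.norm_of_nonneg (Real.exp_pos _).le, sub_re, one_re]

lemma integrableOn_gaussMellin_integrand {ν : ℂ} (hν : 0 < ν.re) {x : ℝ} (hx : 0 < x) (m : ℝ) :
    IntegrableOn
      (fun u : ℝ => (u : ℂ) ^ (ν - 1) * Real.exp (-(u * x ^ 2 + m ^ 2 / (4 * u))))
      (Set.Ioi 0) := by
  have hdom := integrableOn_rpow_mul_exp_neg_mul_rpow (p := 1) (s := ν.re - 1) (b := x ^ 2)
    (by linarith) one_pos (by positivity)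
  have hmeas : AEStronglyMeasurable
      (fun u : ℝ => (u : ℂ) ^ (ν - 1) * Real.exp (-(u * x ^ 2 + m ^ 2 / (4 * u))))
      (volume.restrict (Set.Ioi 0)) := by
    apply Measurable.aestronglyMeasurable
    fun_prop
  refine hdom.mono' hmeas ?_
  filter_upwards [ae_restrict_mem measurableSet_Ioi] with u (hu : 0 < u)
  rw [norm_gaussMellin_integrand ν x m hu, Real.rpow_one]
  gcongr
  have : 0 ≤ m ^ 2 / (4 * u) := by positivity
  linarith

lemma ofReal_integral_norm_gaussMellin (ν : ℂ) (x m : ℝ) :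
    ((∫ u in Set.Ioi (0 : ℝ),
      ‖(u : ℂ) ^ (ν - 1) * Real.exp (-(u * x ^ 2 + m ^ 2 / (4 * u)))‖ : ℝ) : ℂ) =
      gaussMellin ν.re x m := by
  rw [gaussMellin, ← integral_complex_ofReal]
  refine setIntegral_congr_fun measurableSet_Ioi fun u (hu : 0 < u) => ?_
  rw [norm_gaussMellin_integrand ν x m hu, ofReal_mul, ofReal_cpow hu.le, ofReal_sub, ofReal_one]

lemma hasSum_int_gaussMellin {ν : ℂ} (hν : 0 < ν.re) {x : ℝ} (hx : 0 < x) :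
    HasSum (fun n : ℤ => gaussMellin ν x n)
      (((x : ℂ) ^ (2 * ν))⁻¹ * (Gamma ν +
        4 * ∑' n : ℕ, ((n + 1 : ℕ) * (x : ℂ) / 2) ^ ν * besselK ν ((n + 1 : ℕ) * x))) := by
  have hsum : Summable fun n : ℕ => gaussMellin ν x ((n + 1 : ℕ) : ℤ) := by
    simp only [Int.cast_natCast, gaussMellin_succ ν hx]
    exact ((summable_and_differentiableOn_besselK_series hν).1 x (by simpa)).mul_left _
  convert hasSum_int_of_even (f := fun n : ℤ => gaussMellin ν x n)
    (fun n => by simp [gaussMellin]) hsum using 1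
  simp only [Int.cast_natCast, gaussMellin_succ ν hx, Int.cast_zero, gaussMellin_zero hν hx,
    tsum_mul_left]
  ring

lemma hasSum_gaussMellin_integral {ν : ℂ} (hν : 0 < ν.re) {x : ℝ} (hx : 0 < x) :
    HasSum (fun n : ℤ => gaussMellin ν x n)
      (∫ u in Set.Ioi (0 : ℝ),
        ∑' n : ℤ, (u : ℂ) ^ (ν - 1) * Real.exp (-(u * x ^ 2 + (n : ℝ) ^ 2 / (4 * u)))) := by
  refine hasSum_integral_of_summable_integral_norm
    (fun n => integrableOn_gaussMellin_integrand hν hx n) ?_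
  rw [← summable_ofReal]
  simp only [ofReal_integral_norm_gaussMellin]
  exact (hasSum_int_gaussMellin (ν := ν.re) (by simpa) hx).summable

lemma summable_exp_neg_mul_int_sq {a : ℝ} (ha : 0 < a) :
    Summable fun n : ℤ => Real.exp (-Real.pi * a * (n : ℝ) ^ 2) := by
  refine (HurwitzKernelBounds.summable_f_int 0 0 ha).congr fun n => ?_
  simp only [HurwitzKernelBounds.f_int, pow_zero, one_mul, add_zero]
  ring_nf

lemma theta_transformation (ν : ℂ) {u : ℝ} (hu : 0 < u) (x : ℝ) :
    (u : ℂ) ^ (ν + 1 / 2 - 1) *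
        ((∑' n : ℤ, Real.exp (-(x ^ 2 + 4 * (n : ℝ) ^ 2 * Real.pi ^ 2) * u) : ℝ) : ℂ) =
      (2 * (Real.sqrt Real.pi : ℂ))⁻¹ *
        ∑' n : ℤ, (u : ℂ) ^ (ν - 1) * Real.exp (-(u * x ^ 2 + (n : ℝ) ^ 2 / (4 * u))) := by
  have hu0 : (u : ℂ) ≠ 0 := ofReal_ne_zero.2 hu.ne'
  have h1 : ∀ n : ℤ, Real.exp (-(x ^ 2 + 4 * (n : ℝ) ^ 2 * Real.pi ^ 2) * u) =
      Real.exp (-(u * x ^ 2)) * Real.exp (-Real.pi * (4 * Real.pi * u) * (n : ℝ) ^ 2) := by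
    intro n
    rw [← Real.exp_add]
    ring_nf
  have h2 : ∀ n : ℤ, Real.exp (-(u * x ^ 2 + (n : ℝ) ^ 2 / (4 * u))) =
      Real.exp (-(u * x ^ 2)) * Real.exp (-Real.pi / (4 * Real.pi * u) * (n : ℝ) ^ 2) := by
    intro n
    rw [← Real.exp_add]
    congr 1
    field_simp
    ring
  have hsqrt : (4 * Real.pi * u) ^ (1 / 2 : ℝ) = 2 * Real.sqrt Real.pi * Real.sqrt u := by
    rw [← Real.sqrt_eq_rpow, Real.sqrt_mul (by positivity), Real.sqrt_mul (by positivity),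
      show (4 : ℝ) = 2 ^ 2 by norm_num, Real.sqrt_sq zero_le_two]
  have hhalf : (u : ℂ) ^ (ν + 1 / 2 - 1) = (u : ℂ) ^ (ν - 1) * (Real.sqrt u : ℂ) := by
    rw [add_sub_right_comm, cpow_add _ _ hu0, Real.sqrt_eq_rpow, ofReal_cpow hu.le]
    push_cast
    rfl
  have hsu : (Real.sqrt u : ℂ) ≠ 0 := ofReal_ne_zero.2 (Real.sqrt_pos.2 hu).ne'
  have hsp : (Real.sqrt Real.pi : ℂ) ≠ 0 := ofReal_ne_zero.2 (Real.sqrt_pos.2 Real.pi_pos).ne'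
  rw [tsum_mul_left, ← ofReal_tsum]
  simp only [h1, h2]
  rw [tsum_mul_left, tsum_mul_left, Real.tsum_exp_neg_mul_int_sq (by positivity), hsqrt, hhalf]
  push_cast
  field_simp

lemma hasSum_int_one_div_sq_add_cpow {s : ℂ} (hs : 1 / 2 < s.re) {x : ℝ} (hx : 0 < x) :
    HasSum (fun n : ℤ => 1 / ((x ^ 2 + 4 * (n : ℝ) ^ 2 * Real.pi ^ 2 : ℝ) : ℂ) ^ s)
      (1 / (x : ℂ) ^ (2 * s) + 2 * ∑' n : ℕ,
        1 / ((x : ℂ) ^ 2 + 4 * ((n + 1 : ℕ) : ℂ) ^ 2 * (Real.pi : ℂ) ^ 2) ^ s) := by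
  have hcast : ∀ n : ℕ, ((x ^ 2 + 4 * (((n + 1 : ℕ) : ℤ) : ℝ) ^ 2 * Real.pi ^ 2 : ℝ) : ℂ) =
      (x : ℂ) ^ 2 + 4 * ((n + 1 : ℕ) : ℂ) ^ 2 * (Real.pi : ℂ) ^ 2 := by
    intro n
    push_cast
    rfl
  have hsum := (summable_and_differentiableOn_inv_cpow_series hs).1 x (by simpa)
  simp only [← hcast] at hsum
  convert hasSum_int_of_even
    (f := fun n : ℤ => 1 / ((x ^ 2 + 4 * (n : ℝ) ^ 2 * Real.pi ^ 2 : ℝ) : ℂ) ^ s)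
    (fun n => by simp) hsum using 1
  simp only [hcast, ofReal_cpow_two_mul hx.le]
  simp

lemma hasSum_Gamma_div_cpow {s : ℂ} (hs : 1 / 2 < s.re) {x : ℝ} (hx : 0 < x) :
    HasSum (fun n : ℤ => Gamma s * 1 / ((x ^ 2 + 4 * (n : ℝ) ^ 2 * Real.pi ^ 2 : ℝ) : ℂ) ^ s)
      (mellin (fun u => ((∑' n : ℤ,
        Real.exp (-(x ^ 2 + 4 * (n : ℝ) ^ 2 * Real.pi ^ 2) * u) : ℝ) : ℂ)) s) := by
  have hp : ∀ n : ℤ, 0 < x ^ 2 + 4 * (n : ℝ) ^ 2 * Real.pi ^ 2 := fun n => by positivity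
  refine hasSum_mellin (a := fun _ => 1) (fun n => .inr (hp n)) (by linarith)
    (fun u (hu : 0 < u) => ?_) ?_
  · simp only [one_mul]
    rw [hasSum_ofReal]
    have h := (summable_exp_neg_mul_int_sq (by positivity : 0 < 4 * Real.pi * u)).mul_left
      (Real.exp (-(u * x ^ 2)))
    refine (h.congr fun n => ?_).hasSum
    rw [← Real.exp_add]
    ring_nf
  · have h := (hasSum_int_one_div_sq_add_cpow (s := s.re) (by simpa using hs) hx).summable.norm
    refine h.congr fun n => ?_
    rw [norm_div, norm_cpow_eq_rpow_re_of_pos (hp n), ofReal_re]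

/-- **Watson's formula** for positive real argument. -/
lemma watson_formula_ofReal {ν : ℂ} (hν : 0 < ν.re) {x : ℝ} (hx : 0 < x) :
    (1 / 2) * Gamma ν
        + 2 * ∑' n : ℕ, ((n + 1 : ℕ) * (x : ℂ) / 2) ^ ν * besselK ν ((n + 1 : ℕ) * x)
      = (Real.sqrt Real.pi : ℂ) * Gamma (ν + 1 / 2) * (x : ℂ) ^ (2 * ν)
          * (1 / (x : ℂ) ^ (2 * ν + 1)
            + 2 * ∑' n : ℕ,
                1 / ((x : ℂ) ^ 2 + 4 * ((n + 1 : ℕ) : ℂ) ^ 2 * (Real.pi : ℂ) ^ 2)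
                  ^ (ν + 1 / 2)) := by
  have hs : 1 / 2 < (ν + 1 / 2).re := by
    rw [add_re, show ((1 : ℂ) / 2).re = 1 / 2 by norm_num]
    linarith
  have hmellin := hasSum_Gamma_div_cpow hs hx
  simp only [mul_div_assoc] at hmellin
  have hleft := hmellin.unique
    ((hasSum_int_one_div_sq_add_cpow hs hx).mul_left (Gamma (ν + 1 / 2)))
  have hright := (hasSum_int_gaussMellin hν hx).unique (hasSum_gaussMellin_integral hν hx)
  simp only [mellin, smul_eq_mul] at hleft
  rw [setIntegral_congr_fun measurableSet_Ioi
    fun u hu => theta_transformation ν (Set.mem_Ioi.1 hu) x, integral_const_mul, ← hright] at hleft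
  rw [mul_add 2 ν, mul_one_div_cancel two_ne_zero] at hleft
  have hne : (x : ℂ) ^ (2 * ν) ≠ 0 := by simp [cpow_eq_zero_iff, hx.ne']
  have hsp : (Real.sqrt Real.pi : ℂ) ≠ 0 := ofReal_ne_zero.2 (Real.sqrt_pos.2 Real.pi_pos).ne'
  rw [mul_right_comm, mul_assoc _ (Gamma (ν + 1 / 2)), ← hleft]
  generalize ∑' n : ℕ, ((n + 1 : ℕ) * (x : ℂ) / 2) ^ ν * besselK ν ((n + 1 : ℕ) * x) = S
  field_simp
  ring

end RealArgument

/-- **Watson's formula.**  For `Re ν > 0` and `Re z > 0`,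
`(1/2) Γ(ν) + 2 ∑_{n=1}^∞ (nz/2)^ν K_ν(nz)
  = √π Γ(ν + 1/2) z^{2ν} (1/z^{2ν+1} + 2 ∑_{n=1}^∞ 1/(z² + 4n²π²)^{ν+1/2})`,
both series converging absolutely. -/
theorem watson_formula (ν z : ℂ) (hν : 0 < ν.re) (hz : 0 < z.re) :
    Summable (fun n : ℕ => ((n+1 : ℕ) * z / 2) ^ ν * besselK ν ((n+1 : ℕ) * z)) ∧
    Summable (fun n : ℕ =>
      1 / (z^2 + 4 * ((n+1 : ℕ) : ℂ)^2 * (Real.pi : ℂ)^2) ^ (ν + 1/2)) ∧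
    (1/2) * Complex.Gamma ν
        + 2 * ∑' n : ℕ, ((n+1 : ℕ) * z / 2) ^ ν * besselK ν ((n+1 : ℕ) * z)
      = (Real.sqrt Real.pi : ℂ) * Complex.Gamma (ν + 1/2) * z ^ (2*ν)
          * (1 / z ^ (2*ν + 1)
            + 2 * ∑' n : ℕ,
                1 / (z^2 + 4 * ((n+1 : ℕ) : ℂ)^2 * (Real.pi : ℂ)^2) ^ (ν + 1/2)) := by
  have hs : 1 / 2 < (ν + 1 / 2).re := by
    rw [add_re, show ((1 : ℂ) / 2).re = 1 / 2 by norm_num]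
    linarith
  obtain ⟨hsumK, hdiffK⟩ := summable_and_differentiableOn_besselK_series hν
  obtain ⟨hsumP, hdiffP⟩ := summable_and_differentiableOn_inv_cpow_series hs
  refine ⟨hsumK z hz, hsumP z hz, ?_⟩
  have hopen : IsOpen {w : ℂ | 0 < w.re} := isOpen_lt continuous_const continuous_re
  have hpow : ∀ a : ℂ, DifferentiableOn ℂ (fun w : ℂ => w ^ a) {w | 0 < w.re} := fun a w hw =>
    (differentiableAt_id.cpow (differentiableAt_const a)
      (mem_slitPlane_iff.2 (.inl hw))).differentiableWithinAt
  have hne : ∀ w ∈ {w : ℂ | 0 < w.re}, w ^ (2 * ν + 1) ≠ 0 := by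
    intro w hw h
    simp [((cpow_eq_zero_iff _ _).1 h).1] at hw
  have hleft := ((hdiffK.const_mul 2).const_add ((1 / 2) * Gamma ν)).analyticOnNhd hopen
  have hright := (((hpow (2 * ν)).const_mul ((Real.sqrt Real.pi : ℂ) * Gamma (ν + 1 / 2))).mul
    (((differentiableOn_const 1).div (hpow (2 * ν + 1)) hne).add
      (hdiffP.const_mul 2))).analyticOnNhd hopen
  refine hleft.eqOn_of_preconnected_of_frequently_eq hright
    (convex_halfSpace_re_gt 0).isPreconnected (z₀ := 1) (by simp) ?_ hz
  have htendsto : Tendsto (fun x : ℝ => (x : ℂ)) (nhdsWithin 1 {1}ᶜ) (nhdsWithin 1 {1}ᶜ) := by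
    refine tendsto_nhdsWithin_iff.2 ⟨?_, ?_⟩
    · exact (continuous_ofReal.tendsto' 1 1 ofReal_one).mono_left nhdsWithin_le_nhds
    · filter_upwards [self_mem_nhdsWithin] with x hx
      simpa using hx
  refine htendsto.frequently (Eventually.frequently ?_)
  filter_upwards [nhdsWithin_le_nhds (lt_mem_nhds one_pos)] with x hx
  exact watson_formula_ofReal hν hx
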